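/- arXiv:2503.06811 — 2 statements merged into one kernel-verified Lean document; each statement's English description precedes it below -/
import Mathlib

section
/- Let a ≥ 0, b ∈ ℝ, T > 0, and let G : ℝ → ℝ be four times continuously differentiable, with G and all its derivatives up to order 4 in L¹(ℝ), and with G and its derivatives up to order 3 tending to 0 as |x| → ∞. Let F : ℝ × ℝ → ℝ be measurable with |F(u₁,x) − F(u₂,x)| ≤ l|u₁ − u₂| for all u₁, u₂, x, where l > 0. Let v₁, v₂ : ℝ × [0,T] → ℝ be measurable with vⱼ(·,t) ∈ L²(ℝ) for a.e. t, ∫₀ᵀ ‖vⱼ(·,t)‖²_{L²(ℝ)} dt < ∞, and x ↦ F(vⱼ(x,s),x) in L¹(ℝ) ∩ L²(ℝ) for a.e. s (j = 1,2); write f̂_{vⱼ}(p,s) for the Fourier transform of x ↦ F(vⱼ(x,s),x), and set W(p,t) := ∫₀ᵗ e^{(t−s)(−p⁴+ibp+a)} √(2π) Ĝ(p) ( f̂_{v₁}(p,s) − f̂_{v₂}(p,s) ) ds. Then ∫₀ᵀ ∫_ℝ p⁸ |W(p,t)|² dp dt ≤ e^{2aT} l² T² ‖d⁴G/dx⁴‖²_{L¹(ℝ)}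 ‖v₁ − v₂‖²_{L²(ℝ×[0,T])}. -/
open MeasureTheory

/-- The Fourier transform `φ̂(p) = (2π)^{-1/2} ∫ φ(x) e^{-ipx} dx`. -/
noncomputable def FT (φ : ℝ → ℝ) (p : ℝ) : ℂ :=
  (Real.sqrt (2 * Real.pi))⁻¹ *
    ∫ x : ℝ, (φ x : ℂ) * Complex.exp (-(Complex.I * p * x))

open scoped FourierTransform SchwartzMap in
lemma aux_plancherel (f : ℝ → ℂ) (h1 : Integrable f) (h2 : MemLp f 2) :
    ∫⁻ p, ‖𝓕 f p‖ₑ ^ 2 = ∫⁻ x, ‖f x‖ₑ ^ 2 := by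
  set g : Lp ℂ 2 (volume : Measure ℝ) := h2.toLp f with hg
  have hcont : Continuous (𝓕 f) :=
    VectorFourier.fourierIntegral_continuous Real.continuous_fourierChar continuous_inner h1
  have hae : ∀ᵐ x, (𝓕 g : Lp ℂ 2 (volume : Measure ℝ)) x = 𝓕 f x := by
    apply ae_eq_of_integral_contDiff_smul_eq
    · exact (Lp.memLp _).locallyIntegrable (by norm_num)
    · exact hcont.locallyIntegrable
    · intro φ φs φc
      have hg₁ : HasCompactSupport (Complex.ofRealCLM ∘ φ) := φc.comp_left rfl
      have hg₂ : ContDiff ℝ (⊤ : ℕ∞) (Complex.ofRealCLM ∘ φ) := by fun_prop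
      set ψ : 𝓢(ℝ, ℂ) := hg₁.toSchwartzMap hg₂ with hψ
      have e1 : ∀ x, ψ x = (φ x : ℂ) := fun x => rfl
      have e2 := congrArg (fun L => L ψ) (Lp.fourier_toTemperedDistribution_eq g)
      simp only [TemperedDistribution.fourier_apply, Lp.toTemperedDistribution_apply] at e2
      have e3 := VectorFourier.integral_fourierIntegral_smul_eq_flip (L := innerₗ ℝ) (μ := volume) (ν := volume)
        Real.continuous_fourierChar continuous_inner (ψ.integrable (μ := volume)) h1
      calc _ = ∫ x, ψ x • (𝓕 g : Lp ℂ 2 (volume : Measure ℝ)) x := by simp [e1]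
        _ = ∫ x, (𝓕 ψ) x • g x := e2.symm
        _ = ∫ x, (𝓕 ψ) x • f x := by
          apply integral_congr_ae
          filter_upwards [h2.coeFn_toLp] with x hx
          rw [hg, hx]
        _ = ∫ x, ψ x • 𝓕 f x := by
          simpa using! e3
        _ = _ := by simp [e1]
  have hn : eLpNorm (𝓕 f) 2 volume = eLpNorm f 2 volume := by
    rw [← eLpNorm_congr_ae hae, ← eLpNorm_congr_ae h2.coeFn_toLp]
    have := Lp.norm_fourier_eq g
    rw [Lp.norm_def, Lp.norm_def] at this
    exact (ENNReal.toReal_eq_toReal_iff' (Lp.eLpNorm_ne_top _) (Lp.eLpNorm_ne_top _)).1 this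
  have := congrArg (fun z => z ^ (2:ℝ)) hn
  simp only [eLpNorm_eq_lintegral_rpow_enorm_toReal (two_ne_zero) (ENNReal.ofNat_ne_top)] at this
  simp only [← ENNReal.rpow_mul] at this
  simpa using this

open scoped FourierTransform in
lemma aux_FT (φ : ℝ → ℝ) (p : ℝ) :
    FT φ p = (Real.sqrt (2 * Real.pi))⁻¹ * 𝓕 (fun x => (φ x : ℂ)) ((2 * Real.pi)⁻¹ * p) := by
  rw [FT, Real.fourier_real_eq_integral_exp_smul]
  congr 1
  apply integral_congr_ae
  filter_upwards with x
  rw [smul_eq_mul, mul_comm]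
  congr 2
  push_cast
  have : (Real.pi : ℂ) ≠ 0 := by exact_mod_cast Real.pi_ne_zero
  field_simp

lemma aux_scale (h : ℝ → ENNReal) (c : ℝ) (hc : 0 < c) :
    ∫⁻ p, h (c * p) = ENNReal.ofReal c⁻¹ * ∫⁻ p, h p := by
  have e := (Homeomorph.mulLeft₀ c hc.ne').toMeasurableEquiv
  have := lintegral_map_equiv (μ := (volume : Measure ℝ)) h (Homeomorph.mulLeft₀ c hc.ne').toMeasurableEquiv
  have h2 := Real.map_volume_mul_left hc.ne'
  simp only [Homeomorph.toMeasurableEquiv_coe, Homeomorph.coe_mulLeft₀] at this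
  rw [← this, h2, lintegral_smul_measure, abs_of_pos (by positivity), smul_eq_mul]

lemma aux_FT_plancherel (φ : ℝ → ℝ) (h1 : Integrable φ) (h2 : Integrable (fun x => φ x ^ 2)) :
    ∫⁻ p, ‖FT φ p‖ₑ ^ 2 = ∫⁻ x, ‖φ x‖ₑ ^ 2 := by
  have h1' : Integrable (fun x => (φ x : ℂ)) := h1.ofReal
  have h2' : MemLp (fun x => (φ x : ℂ)) 2 :=
    ((memLp_two_iff_integrable_sq h1.aestronglyMeasurable).2 h2).ofReal
  have := aux_plancherel _ h1' h2'
  have hp : 0 < Real.pi := Real.pi_pos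
  have e : ∀ p, ‖FT φ p‖ₑ ^ 2 = ENNReal.ofReal ((2 * Real.pi)⁻¹) *
      (fun q => ‖FourierTransform.fourier (fun x => (φ x : ℂ)) q‖ₑ ^ 2) ((2 * Real.pi)⁻¹ * p) := by
    intro p
    rw [aux_FT, enorm_mul, mul_pow]
    congr 1
    rw [← ofReal_norm, ← ENNReal.ofReal_pow (norm_nonneg _)]
    congr 1
    simp only [norm_inv, Complex.norm_real, Real.norm_eq_abs, inv_pow, sq_abs]
    rw [Real.sq_sqrt (by positivity)]
  simp_rw [e]
  rw [lintegral_const_mul' _ _ ENNReal.ofReal_ne_top, aux_scale (fun q => ‖FourierTransform.fourier (fun x => (φ x : ℂ)) q‖ₑ ^ 2) _ (by positivity), ← mul_assoc, ← ENNReal.ofReal_mul (by positivity), inv_inv, inv_mul_cancel₀ (by positivity)]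
  have hn : ∀ x, ‖(φ x : ℂ)‖ₑ = ‖φ x‖ₑ := fun x => by
    rw [← ofReal_norm, ← ofReal_norm, Complex.norm_real]
  simp only [hn] at this
  simpa using this

lemma aux_cs (S : Measure ℝ) (f : ℝ → ENNReal) (hf : AEMeasurable f S) :
    (∫⁻ s, f s ∂S) ^ 2 ≤ S Set.univ * ∫⁻ s, f s ^ 2 ∂S := by
  have := ENNReal.lintegral_mul_le_Lp_mul_Lq S Real.HolderConjugate.two_two hf
    (aemeasurable_const (b := (1:ENNReal)))
  have h2 : ((∫⁻ s, f s ∂S)) ≤ (∫⁻ s, f s ^ 2 ∂S) ^ (1/2 : ℝ) * (S Set.univ) ^ (1/2:ℝ) := by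
    simpa using this
  calc _ ≤ _ := pow_le_pow_left' h2 2
    _ = _ := by
      rw [mul_pow, ← ENNReal.rpow_natCast, ← ENNReal.rpow_mul, ← ENNReal.rpow_natCast,
        ← ENNReal.rpow_mul]
      norm_num [mul_comm]

lemma aux_G (G : ℝ → ℝ) (hGsmooth : ContDiff ℝ 4 G)
    (hGint : ∀ n : ℕ, n ≤ 4 → Integrable (iteratedDeriv n G)) (p : ℝ) :
    |p| ^ 4 * ‖(Real.sqrt (2 * Real.pi) : ℂ) * FT G p‖ ≤ ∫ x : ℝ, |iteratedDeriv 4 G x| := by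
  have hp : 0 < Real.pi := Real.pi_pos
  have hd : ∀ n : ℕ, n ≤ 4 → iteratedDeriv n (fun x => (G x : ℂ)) = fun x => ((iteratedDeriv n G x : ℝ) : ℂ) := by
    intro n
    induction n with
    | zero => intro _; simp
    | succ n ih =>
      intro hn
      rw [iteratedDeriv_succ, ih (by omega)]
      funext x
      rw [iteratedDeriv_succ]
      apply HasDerivAt.deriv
      apply HasDerivAt.ofReal_comp
      apply DifferentiableAt.hasDerivAt
      exact (hGsmooth.differentiable_iteratedDeriv n (by exact_mod_cast (by omega : n < 4))) x
  have hc : ContDiff ℝ ((4 : ℕ∞) : WithTop ℕ∞) (fun x => (G x : ℂ)) :=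
    Complex.ofRealCLM.contDiff.comp hGsmooth
  have key := congrFun (Real.fourier_iteratedDeriv (n := 4) hc (by
    intro n hn
    have hn' : n ≤ 4 := by exact_mod_cast hn
    rw [hd n hn']
    exact (hGint n hn').ofReal) (le_refl _)) ((2 * Real.pi)⁻¹ * p)
  have hb := VectorFourier.norm_fourierIntegral_le_integral_norm Real.fourierChar volume (innerₗ ℝ)
    (iteratedDeriv 4 (fun x => (G x : ℂ))) ((2 * Real.pi)⁻¹ * p)
  have hb' := (congrArg norm key).symm.trans_le hb
  rw [hd 4 le_rfl] at hb'
  simp only [Complex.norm_real, Real.norm_eq_abs] at hb'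
  refine le_trans (le_of_eq ?_) hb'
  rw [aux_FT, norm_smul, ← mul_assoc]
  have hs : (Real.sqrt (2 * Real.pi) : ℂ) ≠ 0 := by
    exact_mod_cast (Real.sqrt_pos.2 (by positivity)).ne'
  rw [Complex.ofReal_inv, mul_inv_cancel₀ hs, one_mul]
  congr 1
  rw [norm_pow]
  congr 1
  simp only [norm_mul, Complex.norm_real, Complex.norm_I, Complex.norm_ofNat, Real.norm_eq_abs, abs_mul, abs_inv, abs_of_pos hp, abs_of_pos (two_pos : (0:ℝ) < 2)]
  field_simp

lemma aux_meas (f : ℝ → ℝ → ℝ) (hf : Measurable (Function.uncurry f)) :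
    Measurable (fun z : ℝ × ℝ => FT (fun x => f x z.2) z.1) := by
  unfold FT
  apply Measurable.const_mul
  have : StronglyMeasurable (fun w : (ℝ × ℝ) × ℝ => ((f w.2 w.1.2 : ℝ) : ℂ) * Complex.exp (-(Complex.I * w.1.1 * w.2))) := by
    apply Measurable.stronglyMeasurable
    have : Measurable (fun w : (ℝ × ℝ) × ℝ => f w.2 w.1.2) :=
      hf.comp (f := fun w : (ℝ × ℝ) × ℝ => (w.2, w.1.2)) (by fun_prop)
    fun_prop
  exact this.integral_prod_right'.measurable

theorem stmt13 (a b T l : ℝ) (ha : 0 ≤ a) (hT : 0 < T) (hl : 0 < l)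
    (G : ℝ → ℝ) (hGsmooth : ContDiff ℝ 4 G)
    (hGint : ∀ n : ℕ, n ≤ 4 → Integrable (iteratedDeriv n G))
    (hGdecay : ∀ n : ℕ, n ≤ 3 →
      Filter.Tendsto (iteratedDeriv n G) (Filter.cocompact ℝ) (nhds 0))
    (F : ℝ → ℝ → ℝ) (hFmeas : Measurable (Function.uncurry F))
    (hlip : ∀ u₁ u₂ x : ℝ, |F u₁ x - F u₂ x| ≤ l * |u₁ - u₂|)
    (v₁ v₂ : ℝ → ℝ → ℝ)
    (hv₁meas : Measurable (Function.uncurry v₁))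
    (hv₂meas : Measurable (Function.uncurry v₂))
    (hv₁2 : ∀ᵐ t ∂(volume.restrict (Set.Icc (0:ℝ) T)),
      Integrable (fun x => (v₁ x t) ^ 2))
    (hv₂2 : ∀ᵐ t ∂(volume.restrict (Set.Icc (0:ℝ) T)),
      Integrable (fun x => (v₂ x t) ^ 2))
    (hv₁L2 : (∫⁻ t in Set.Icc (0:ℝ) T,
      ENNReal.ofReal (∫ x : ℝ, (v₁ x t) ^ 2)) < ⊤)
    (hv₂L2 : (∫⁻ t in Set.Icc (0:ℝ) T,
      ENNReal.ofReal (∫ x : ℝ, (v₂ x t) ^ 2)) < ⊤)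
    (hFv₁ : ∀ᵐ s ∂(volume.restrict (Set.Icc (0:ℝ) T)),
      Integrable (fun x => F (v₁ x s) x) ∧ Integrable (fun x => (F (v₁ x s) x) ^ 2))
    (hFv₂ : ∀ᵐ s ∂(volume.restrict (Set.Icc (0:ℝ) T)),
      Integrable (fun x => F (v₂ x s) x) ∧ Integrable (fun x => (F (v₂ x s) x) ^ 2))
    (W : ℝ → ℝ → ℂ)
    (hW : ∀ p t : ℝ, W p t = ∫ s in (0:ℝ)..t,
      Complex.exp (((t - s : ℝ) : ℂ) * (-(p : ℂ) ^ 4 + Complex.I * b * p + a)) *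
        (Real.sqrt (2 * Real.pi) : ℂ) *
        FT G p * (FT (fun x => F (v₁ x s) x) p - FT (fun x => F (v₂ x s) x) p)) :
    ∫ t in (0:ℝ)..T, ∫ p : ℝ, p ^ 8 * ‖W p t‖ ^ 2 ≤
      Real.exp (2 * a * T) * l ^ 2 * T ^ 2 * (∫ x : ℝ, |iteratedDeriv 4 G x|) ^ 2 *
        ∫ t in (0:ℝ)..T, ∫ x : ℝ, (v₁ x t - v₂ x t) ^ 2 := by
  classical
  set S : Measure ℝ := volume.restrict (Set.Ioc (0:ℝ) T) with hS
  have hSI : volume.restrict (Set.Icc (0:ℝ) T) = S := by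
    rw [hS]; exact (restrict_Ioc_eq_restrict_Icc).symm
  rw [hSI] at hv₁2 hv₂2 hv₁L2 hv₂L2 hFv₁ hFv₂
  have hSu : S Set.univ = ENNReal.ofReal T := by simp [hS]
  set K : ℝ := ∫ x : ℝ, |iteratedDeriv 4 G x| with hK
  have hK0 : 0 ≤ K := integral_nonneg fun x => abs_nonneg _
  set D : ℝ → ℝ → ℂ := fun p s =>
    FT (fun x => F (v₁ x s) x) p - FT (fun x => F (v₂ x s) x) p with hD
  have hm₁ : Measurable (Function.uncurry fun x s => F (v₁ x s) x) :=
    hFmeas.comp (hv₁meas.prodMk measurable_fst)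
  have hm₂ : Measurable (Function.uncurry fun x s => F (v₂ x s) x) :=
    hFmeas.comp (hv₂meas.prodMk measurable_fst)
  have hDm : Measurable (fun z : ℝ × ℝ => D z.1 z.2) :=
    (aux_meas _ hm₁).sub (aux_meas _ hm₂)
  set J : ℝ → ℝ := fun t => ∫ x : ℝ, (v₁ x t - v₂ x t) ^ 2 with hJ
  have hJ0 : ∀ t, 0 ≤ J t := fun t => integral_nonneg fun x => sq_nonneg _
  have hvint : ∀ᵐ t ∂S, Integrable (fun x => (v₁ x t - v₂ x t) ^ 2) ∧
      J t ≤ 2 * (∫ x, v₁ x t ^ 2) + 2 * (∫ x, v₂ x t ^ 2) := by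
    filter_upwards [hv₁2, hv₂2] with t h1 h2
    have hd : Integrable (fun x => 2 * v₁ x t ^ 2 + 2 * v₂ x t ^ 2) :=
      (h1.const_mul 2).add (h2.const_mul 2)
    have hle : ∀ x, (v₁ x t - v₂ x t) ^ 2 ≤ 2 * v₁ x t ^ 2 + 2 * v₂ x t ^ 2 := fun x => by
      nlinarith [sq_nonneg (v₁ x t + v₂ x t)]
    have hi : Integrable (fun x => (v₁ x t - v₂ x t) ^ 2) := by
      refine hd.mono' ?_ (Filter.Eventually.of_forall fun x => ?_)
      · have a1 : Measurable fun x => v₁ x t := hv₁meas.comp (measurable_id.prodMk measurable_const)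
        have a2 : Measurable fun x => v₂ x t := hv₂meas.comp (measurable_id.prodMk measurable_const)
        exact ((a1.sub a2).pow_const 2).aestronglyMeasurable
      · rw [Real.norm_of_nonneg (sq_nonneg _)]; exact hle x
    refine ⟨hi, (integral_mono hi hd hle).trans (le_of_eq ?_)⟩
    rw [integral_add (h1.const_mul 2) (h2.const_mul 2), integral_const_mul, integral_const_mul]
  have hmJ : ∀ u : ℝ → ℝ → ℝ, Measurable (Function.uncurry u) →
      Measurable (fun t => ∫ x, u x t ^ 2) := by
    intro u hu
    have : StronglyMeasurable (fun w : ℝ × ℝ => (u w.2 w.1) ^ 2) :=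
      ((hu.comp measurable_swap).pow_const 2).stronglyMeasurable
    exact this.integral_prod_right'.measurable
  have hJm : Measurable J := hmJ (fun x t => v₁ x t - v₂ x t) (hv₁meas.sub hv₂meas)
  have hJfin : ∫⁻ t, ENNReal.ofReal (J t) ∂S < ⊤ := by
    calc ∫⁻ t, ENNReal.ofReal (J t) ∂S
        ≤ ∫⁻ t, (2 * ENNReal.ofReal (∫ x, v₁ x t ^ 2) + 2 * ENNReal.ofReal (∫ x, v₂ x t ^ 2)) ∂S := by
          apply lintegral_mono_ae
          filter_upwards [hvint] with t ht
          refine (ENNReal.ofReal_le_ofReal ht.2).trans (ENNReal.ofReal_add_le.trans (le_of_eq ?_))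
          rw [ENNReal.ofReal_mul two_pos.le, ENNReal.ofReal_mul two_pos.le]
          simp
      _ = 2 * (∫⁻ t, ENNReal.ofReal (∫ x, v₁ x t ^ 2) ∂S) +
            2 * (∫⁻ t, ENNReal.ofReal (∫ x, v₂ x t ^ 2) ∂S) := by
          rw [lintegral_add_left ((hmJ v₁ hv₁meas).ennreal_ofReal.const_mul 2),
            lintegral_const_mul' _ _ (by simp), lintegral_const_mul' _ _ (by simp)]
      _ < ⊤ := ENNReal.add_lt_top.2 ⟨ENNReal.mul_lt_top (by simp) hv₁L2,
          ENNReal.mul_lt_top (by simp) hv₂L2⟩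
  have hJint : Integrable J S := by
    refine ⟨hJm.aestronglyMeasurable, ?_⟩
    rw [hasFiniteIntegral_iff_ofReal (Filter.Eventually.of_forall hJ0)]
    exact hJfin
  have hV : ∫⁻ t, ENNReal.ofReal (J t) ∂S = ENNReal.ofReal (∫ t, J t ∂S) :=
    (ofReal_integral_eq_lintegral_ofReal hJint (Filter.Eventually.of_forall hJ0)).symm
  -- Plancherel and Lipschitz
  have hP : ∀ᵐ s ∂S, ∫⁻ p, ‖D p s‖ₑ ^ 2 ≤ ENNReal.ofReal (l ^ 2) * ENNReal.ofReal (J s) := by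
    filter_upwards [hFv₁, hFv₂, hvint] with s h1 h2 h3
    have hL1 : Integrable (fun x => F (v₁ x s) x - F (v₂ x s) x) := h1.1.sub h2.1
    have hL2 : Integrable (fun x => (F (v₁ x s) x - F (v₂ x s) x) ^ 2) :=
      (((memLp_two_iff_integrable_sq h1.1.aestronglyMeasurable).2 h1.2).sub
        ((memLp_two_iff_integrable_sq h2.1.aestronglyMeasurable).2 h2.2)).integrable_sq
    have hDs : ∀ p, D p s = FT (fun x => F (v₁ x s) x - F (v₂ x s) x) p := by
      intro p
      have hex : ∀ φ : ℝ → ℝ, Integrable φ →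
          Integrable (fun x => (φ x : ℂ) * Complex.exp (-(Complex.I * p * x))) := by
        intro φ hφ
        refine hφ.ofReal.mul_bdd (c := 1) (by fun_prop) (Filter.Eventually.of_forall fun x => ?_)
        rw [Complex.norm_exp]
        simp
      simp only [hD, FT]
      rw [← mul_sub, ← integral_sub (hex _ h1.1) (hex _ h2.1)]
      simp only [Complex.ofReal_sub, sub_mul]
    simp_rw [hDs]
    rw [aux_FT_plancherel _ hL1 hL2, ← ENNReal.ofReal_mul (by positivity), hJ]
    simp only
    rw [← integral_const_mul, ofReal_integral_eq_lintegral_ofReal (h3.1.const_mul _)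
      (Filter.Eventually.of_forall fun x => by positivity)]
    apply lintegral_mono
    intro x
    simp only
    rw [← ofReal_norm, ← ENNReal.ofReal_pow (norm_nonneg _)]
    apply ENNReal.ofReal_le_ofReal
    rw [Real.norm_eq_abs, ← sq_abs (v₁ x s - v₂ x s), ← mul_pow]
    exact pow_le_pow_left₀ (abs_nonneg _) (hlip _ _ _) 2
  have hPP : ∫⁻ p, ∫⁻ s, ‖D p s‖ₑ ^ 2 ∂S ≤ ENNReal.ofReal (l ^ 2) * ENNReal.ofReal (∫ t, J t ∂S) := by
    rw [lintegral_lintegral_swap]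
    · rw [← hV, ← lintegral_const_mul' _ _ ENNReal.ofReal_ne_top]
      exact lintegral_mono_ae hP
    · exact (hDm.enorm.pow_const 2).aemeasurable
  -- pointwise bound
  set C : ℝ := K * Real.exp (a * T) with hC
  have hC0 : 0 ≤ C := by positivity
  have hpt : ∀ t ∈ Set.Ioc 0 T, ∀ p, ‖p ^ 8 * ‖W p t‖ ^ 2‖ₑ ≤
      ENNReal.ofReal (C ^ 2 * T) * ∫⁻ s, ‖D p s‖ₑ ^ 2 ∂S := by
    intro t ht p
    have h1 : ‖((p ^ 4 : ℝ) : ℂ) * W p t‖ₑ ≤ ENNReal.ofReal C * ∫⁻ s, ‖D p s‖ₑ ∂S := by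
      rw [hW, intervalIntegral.integral_of_le ht.1.le, ← integral_const_mul]
      refine (enorm_integral_le_lintegral_enorm _).trans ?_
      rw [← lintegral_const_mul' _ _ ENNReal.ofReal_ne_top]
      refine le_trans ?_ (lintegral_mono_set (Set.Ioc_subset_Ioc_right ht.2))
      apply setLIntegral_mono' measurableSet_Ioc
      intro s hs
      rw [← ofReal_norm, ← ofReal_norm, ← ENNReal.ofReal_mul hC0]
      apply ENNReal.ofReal_le_ofReal
      have hE : ‖Complex.exp (((t - s : ℝ) : ℂ) * (-(p : ℂ) ^ 4 + Complex.I * b * p + a))‖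
          ≤ Real.exp (a * T) := by
        rw [Complex.norm_exp]
        apply Real.exp_le_exp.2
        have : (((t - s : ℝ) : ℂ) * (-(p : ℂ) ^ 4 + Complex.I * b * p + a)).re
            = (t - s) * (-p ^ 4 + a) := by
          rw [Complex.re_ofReal_mul]
          congr 1
          have h4 : ((p : ℂ) ^ 4).re = p ^ 4 := by
            rw [← Complex.ofReal_pow, Complex.ofReal_re]
          simp [h4]
        rw [this]
        have h4 : 0 ≤ p ^ 4 := by positivity
        have hts : 0 ≤ t - s := by linarith [hs.2]
        have hts' : t - s ≤ T := by linarith [hs.1, ht.2]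
        nlinarith [mul_nonneg hts h4, mul_le_mul_of_nonneg_left hts' ha]
      have hG := aux_G G hGsmooth hGint p
      rw [norm_mul] at hG
      simp only [norm_mul, Complex.norm_real, Real.norm_eq_abs] at hG ⊢
      rw [abs_pow]
      calc _ = (|p| ^ 4 * (|Real.sqrt (2 * Real.pi)| * ‖FT G p‖)) *
            ‖Complex.exp (((t - s : ℝ) : ℂ) * (-(p : ℂ) ^ 4 + Complex.I * b * p + a))‖ * ‖D p s‖ := by
            ring
        _ ≤ K * Real.exp (a * T) * ‖D p s‖ := by gcongr
    calc ‖p ^ 8 * ‖W p t‖ ^ 2‖ₑ = ‖((p ^ 4 : ℝ) : ℂ) * W p t‖ₑ ^ 2 := by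
          rw [← ofReal_norm, ← ofReal_norm, ← ENNReal.ofReal_pow (norm_nonneg _)]
          congr 1
          simp only [norm_mul, norm_pow, Complex.norm_real, norm_norm, mul_pow]
          ring
      _ ≤ (ENNReal.ofReal C * ∫⁻ s, ‖D p s‖ₑ ∂S) ^ 2 := pow_le_pow_left' h1 2
      _ = ENNReal.ofReal (C ^ 2) * (∫⁻ s, ‖D p s‖ₑ ∂S) ^ 2 := by
          rw [mul_pow, ENNReal.ofReal_pow hC0]
      _ ≤ ENNReal.ofReal (C ^ 2) * (S Set.univ * ∫⁻ s, ‖D p s‖ₑ ^ 2 ∂S) := by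
          gcongr
          exact aux_cs S _ (hDm.comp (measurable_const.prodMk measurable_id)).enorm.aemeasurable
      _ = _ := by rw [hSu, ← mul_assoc, ← ENNReal.ofReal_mul (by positivity)]
  have hin : ∀ t ∈ Set.Ioc 0 T, ‖∫ p, p ^ 8 * ‖W p t‖ ^ 2‖ₑ ≤
      ENNReal.ofReal (C ^ 2 * T * (l ^ 2 * ∫ t, J t ∂S)) := by
    intro t ht
    refine (enorm_integral_le_lintegral_enorm _).trans ((lintegral_mono (hpt t ht)).trans ?_)
    rw [lintegral_const_mul' _ _ ENNReal.ofReal_ne_top, ENNReal.ofReal_mul (by positivity : (0:ℝ) ≤ C ^ 2 * T),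
      ENNReal.ofReal_mul (by positivity : (0:ℝ) ≤ l ^ 2)]
    gcongr
  have hJS0 : 0 ≤ ∫ t, J t ∂S := integral_nonneg hJ0
  have hB0 : 0 ≤ C ^ 2 * T * (l ^ 2 * ∫ t, J t ∂S) := by positivity
  rw [intervalIntegral.integral_of_le hT.le, intervalIntegral.integral_of_le hT.le]
  change ∫ t, (∫ p : ℝ, p ^ 8 * ‖W p t‖ ^ 2) ∂S ≤
    Real.exp (2 * a * T) * l ^ 2 * T ^ 2 * K ^ 2 * ∫ t, J t ∂S
  have hfin : ‖∫ t, (∫ p : ℝ, p ^ 8 * ‖W p t‖ ^ 2) ∂S‖ ≤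
      (C ^ 2 * T * (l ^ 2 * ∫ t, J t ∂S)) * T := by
    have := norm_setIntegral_le_of_norm_le_const (μ := volume) (s := Set.Ioc 0 T)
      (f := fun t => ∫ p : ℝ, p ^ 8 * ‖W p t‖ ^ 2)
      (C := C ^ 2 * T * (l ^ 2 * ∫ t, J t ∂S)) (by simp) (fun t ht => by
        have := hin t ht
        rw [← ofReal_norm] at this
        exact (ENNReal.ofReal_le_ofReal_iff hB0).1 this)
    simpa [hT.le] using this
  refine (Real.le_norm_self _).trans (hfin.trans (le_of_eq ?_))
  have : Real.exp (2 * a * T) = Real.exp (a * T) ^ 2 := by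
    rw [← Real.exp_nat_mul]; congr 1; push_cast; ring
  rw [this, hC]
  ring
end

section
/- (Contraction estimate of Theorem 1.3.) Let a ≥ 0, b ∈ ℝ, T > 0, and let G : ℝ → ℝ be four times continuously differentiable, with G and all its derivatives up to order 4 in L¹(ℝ), and with G and its derivatives up to order 3 tending to 0 as |x| → ∞; set g := √(‖G‖²_{L¹(ℝ)} + ‖d⁴G/dx⁴‖²_{L¹(ℝ)}). Let F : ℝ × ℝ → ℝ be measurable with |F(u₁,x) − F(u₂,x)| ≤ l|u₁ − u₂| for all u₁, u₂, x, where l > 0. Let v₁, v₂ : ℝ × [0,T] → ℝ be measurable with vⱼ(·,t) ∈ L²(ℝ) for a.e. t, ∫₀ᵀ ‖vⱼ(·,t)‖²_{L²(ℝ)} dt < ∞, and x ↦ F(vⱼ(x,s),x) in L¹(ℝ) ∩ L²(ℝ) for a.e. s (j = 1,2); write f̂_{vⱼ}(p,s) for the Fourier transform of x ↦ F(vⱼ(x,s),x), set W(p,t) := ∫₀ᵗ e^{(t−s)(−p⁴+ibp+a)} √(2π) Ĝ(p) ( f̂_{v₁}(p,s) − f̂_{v₂}(p,s) ) ds, and set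 D(p,t) := (−p⁴+ibp+a) W(p,t) + √(2π) Ĝ(p) ( f̂_{v₁}(p,t) − f̂_{v₂}(p,t) ). Then ∫₀ᵀ ∫_ℝ ( |W(p,t)|² + p⁸ |W(p,t)|² + |D(p,t)|² ) dp dt ≤ g² l² ( T² e^{2aT} (1 + 2(a + |b| + 1)²) + 2 ) ‖v₁ − v₂‖²_{L²(ℝ×[0,T])}. -/
open MeasureTheory

open scoped FourierTransform ENNReal ContDiff in
lemma plancherel_aux (f : ℝ → ℂ) (hf : Integrable f) (hf2 : MemLp f 2) :
    eLpNorm (𝓕 f) 2 = eLpNorm f 2 := by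
  have hae : (𝓕 (hf2.toLp f) : Lp ℂ 2 (volume : Measure ℝ)) =ᵐ[volume] 𝓕 f := by
    apply ae_eq_of_integral_contDiff_smul_eq
    · exact (Lp.memLp _).locallyIntegrable (by norm_num)
    · have : Continuous (𝓕 f) := VectorFourier.fourierIntegral_continuous
        Real.continuous_fourierChar continuous_inner hf
      exact this.locallyIntegrable
    · intro g g_smooth g_cpt
      have hg₁ : HasCompactSupport (Complex.ofRealCLM ∘ g) := g_cpt.comp_left rfl
      have hg₂ : ContDiff ℝ ∞ (Complex.ofRealCLM ∘ g) := by fun_prop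
      set φ := hg₁.toSchwartzMap hg₂ with hφ
      have h1 := congrArg (fun u => u φ) (Lp.fourier_toTemperedDistribution_eq (hf2.toLp f))
      simp only [TemperedDistribution.fourier_apply, Lp.toTemperedDistribution_apply] at h1
      have h2 : ∫ x, (𝓕 φ) x • (hf2.toLp f) x = ∫ x, (𝓕 φ) x • f x := by
        apply integral_congr_ae
        filter_upwards [hf2.coeFn_toLp] with x hx
        rw [hx]
      have h3 : ∫ x, (𝓕 (φ : ℝ → ℂ)) x • f x = ∫ x, φ x • 𝓕 f x := by
        simpa using! (VectorFourier.integral_fourierIntegral_smul_eq_flip (L := innerₗ ℝ)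
          Real.continuous_fourierChar continuous_inner φ.integrable hf)
      rw [h2] at h1
      rw [SchwartzMap.fourier_coe] at h1
      have h4 := h1.symm.trans h3
      simpa [hφ] using h4
  rw [← eLpNorm_congr_ae hae, ← eLpNorm_congr_ae hf2.coeFn_toLp]
  have := Lp.norm_fourier_eq (hf2.toLp f)
  simp only [Lp.norm_def] at this
  exact (ENNReal.toReal_eq_toReal_iff' (Lp.eLpNorm_ne_top _) (Lp.eLpNorm_ne_top _)).1 this

open scoped FourierTransform in
lemma FT_eq (φ : ℝ → ℝ) (p : ℝ) :
    FT φ p = ((Real.sqrt (2 * Real.pi))⁻¹ : ℝ) * 𝓕 (fun x => (φ x : ℂ)) ((2 * Real.pi)⁻¹ * p) := by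
  rw [FT, Real.fourier_real_eq_integral_exp_smul, Complex.ofReal_inv]
  congr 1
  apply integral_congr_ae
  filter_upwards with x
  rw [smul_eq_mul, mul_comm]
  congr 2
  have : (Real.pi : ℂ) ≠ 0 := by exact_mod_cast Real.pi_ne_zero
  push_cast
  field_simp

lemma lint_scale (f : ℝ → ENNReal) (c : ℝ) (hc : 0 < c) :
    ∫⁻ x, f (c * x) = ENNReal.ofReal c⁻¹ * ∫⁻ x, f x := by
  have e := (Homeomorph.mulLeft₀ c hc.ne').toMeasurableEquiv
  have h := lintegral_map_equiv (μ := (volume : Measure ℝ)) f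
    (Homeomorph.mulLeft₀ c hc.ne').toMeasurableEquiv
  have h2 := Real.map_volume_mul_left hc.ne'
  have h3 : ((Homeomorph.mulLeft₀ c hc.ne').toMeasurableEquiv : ℝ → ℝ) = fun x => c * x := rfl
  rw [h3] at h
  change Measure.map (fun x => c * x) volume = _ at h2
  rw [h2, lintegral_smul_measure, abs_of_pos (inv_pos.2 hc)] at h
  simpa using h.symm

open scoped FourierTransform in
lemma FT_sq (φ : ℝ → ℝ) (h1 : Integrable φ) (h2 : Integrable (fun x => φ x ^ 2)) :
    ∫⁻ p, ‖FT φ p‖ₑ ^ 2 = ∫⁻ x, ENNReal.ofReal (φ x ^ 2) := by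
  have hm : MemLp (fun x => (φ x : ℂ)) 2 :=
    ((memLp_two_iff_integrable_sq h1.aestronglyMeasurable).2 h2).ofReal
  have hp := plancherel_aux (fun x => (φ x : ℂ)) h1.ofReal hm
  have key : ∀ f : ℝ → ℂ, eLpNorm f 2 ^ 2 = ∫⁻ x, ‖f x‖ₑ ^ 2 := by
    intro f
    have := eLpNorm_nnreal_pow_eq_lintegral (f := f) (μ := (volume : Measure ℝ)) (p := 2) (by simp)
    simpa using this
  have hp2 := congrArg (fun z => z ^ 2) hp
  simp only [key] at hp2
  have hpi : (0:ℝ) < 2 * Real.pi := by positivity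
  simp_rw [FT_eq, enorm_mul, mul_pow]
  rw [lintegral_const_mul' _ _ (ENNReal.pow_ne_top enorm_ne_top),
    lint_scale (fun x => ‖𝓕 (fun x => (φ x : ℂ)) x‖ₑ ^ 2) _ (inv_pos.2 hpi)]
  refine (congrArg (fun z => _ * (_ * z)) hp2).trans ?_
  rw [← mul_assoc]
  have : ‖(((Real.sqrt (2 * Real.pi))⁻¹ : ℝ) : ℂ)‖ₑ ^ 2 * ENNReal.ofReal (2 * Real.pi)⁻¹⁻¹ = 1 := by
    rw [← ofReal_norm, ← ENNReal.ofReal_pow (norm_nonneg _),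
      ← ENNReal.ofReal_mul (by positivity), Complex.norm_real, Real.norm_eq_abs, sq_abs,
      inv_pow, Real.sq_sqrt hpi.le, inv_inv, inv_mul_cancel₀ hpi.ne', ENNReal.ofReal_one]
  rw [this, one_mul]
  congr 1
  ext x
  rw [← ofReal_norm, ← ENNReal.ofReal_pow (norm_nonneg _), Complex.norm_real,
    Real.norm_eq_abs, sq_abs]

lemma iter_ofReal (G : ℝ → ℝ) (hG : ContDiff ℝ 4 G) (n : ℕ) (hn : n ≤ 4) :
    iteratedDeriv n (fun x => (G x : ℂ)) = fun x => ((iteratedDeriv n G x : ℝ) : ℂ) := by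
  induction n with
  | zero => simp
  | succ k ih =>
    rw [iteratedDeriv_succ, ih (by omega), iteratedDeriv_succ]
    ext x
    have hd : Differentiable ℝ (iteratedDeriv k G) :=
      hG.differentiable_iteratedDeriv k (by exact_mod_cast (by omega : k < 4))
    exact (hd x).hasDerivAt.ofReal_comp.deriv

open scoped FourierTransform in
lemma norm_fourier_le' (f : ℝ → ℝ) (w : ℝ) : ‖𝓕 (fun x => (f x : ℂ)) w‖ ≤ ∫ x, |f x| := by
  have := VectorFourier.norm_fourierIntegral_le_integral_norm Real.fourierChar
    (volume : Measure ℝ) (innerₗ ℝ) (fun x => (f x : ℂ)) w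
  simpa using! this

open scoped FourierTransform in
lemma FT_G_bounds (G : ℝ → ℝ) (hGsmooth : ContDiff ℝ 4 G)
    (hGint : ∀ n : ℕ, n ≤ 4 → Integrable (iteratedDeriv n G)) (p : ℝ) :
    ‖(Real.sqrt (2 * Real.pi) : ℂ) * FT G p‖ ≤ ∫ x, |G x| ∧
    p ^ 4 * ‖(Real.sqrt (2 * Real.pi) : ℂ) * FT G p‖ ≤ ∫ x, |iteratedDeriv 4 G x| := by
  have hpi : (0:ℝ) < 2 * Real.pi := by positivity
  have e : (Real.sqrt (2 * Real.pi) : ℂ) * FT G p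
      = 𝓕 (fun x => (G x : ℂ)) ((2 * Real.pi)⁻¹ * p) := by
    have : (Real.sqrt (2 * Real.pi) : ℂ) ≠ 0 := by
      exact_mod_cast (Real.sqrt_pos.2 hpi).ne'
    rw [FT_eq, ← mul_assoc, Complex.ofReal_inv, mul_inv_cancel₀ this, one_mul]
  rw [e]
  refine ⟨norm_fourier_le' _ _, ?_⟩
  have hc : ContDiff ℝ ((4 : ℕ∞) : WithTop ℕ∞) (fun x => (G x : ℂ)) :=
    Complex.ofRealCLM.contDiff.comp hGsmooth
  have h := Real.fourier_iteratedDeriv (N := 4) (n := 4) hc (by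
    intro n hn
    have hn' : n ≤ 4 := by exact_mod_cast hn
    rw [iter_ofReal G hGsmooth n hn']
    exact (hGint n hn').ofReal) (by norm_num)
  have h2 := norm_fourier_le' (iteratedDeriv 4 G) ((2 * Real.pi)⁻¹ * p)
  rw [← iter_ofReal G hGsmooth 4 le_rfl, h, norm_smul] at h2
  refine le_trans (le_of_eq ?_) h2
  congr 1
  have : (2 * Real.pi * Complex.I * (((2 * Real.pi)⁻¹ * p : ℝ) : ℂ)) = Complex.I * p := by
    have : (Real.pi : ℂ) ≠ 0 := by exact_mod_cast Real.pi_ne_zero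
    push_cast
    field_simp
  rw [this, norm_pow, norm_mul, Complex.norm_I, one_mul, Complex.norm_real, Real.norm_eq_abs,
    Even.pow_abs (by decide)]

lemma FT_meas (u : ℝ → ℝ → ℝ) (hu : Measurable (Function.uncurry u)) :
    Measurable (fun z : ℝ × ℝ => FT (fun x => u x z.2) z.1) := by
  unfold FT
  apply Measurable.const_mul
  apply StronglyMeasurable.measurable
  apply StronglyMeasurable.integral_prod_right'
    (f := fun y : (ℝ × ℝ) × ℝ => ((u y.2 y.1.2 : ℝ) : ℂ) * Complex.exp (-(Complex.I * y.1.1 * y.2)))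
  apply Measurable.stronglyMeasurable
  have h1 : Measurable (fun y : (ℝ × ℝ) × ℝ => u y.2 y.1.2) :=
    hu.comp (measurable_snd.prodMk (measurable_snd.comp measurable_fst))
  have h2 : Measurable (fun y : (ℝ × ℝ) × ℝ => ((u y.2 y.1.2 : ℝ) : ℂ)) :=
    Complex.measurable_ofReal.comp h1
  apply h2.mul
  fun_prop

lemma FT_sub (f h : ℝ → ℝ) (hf : Integrable f) (hh : Integrable h) (p : ℝ) :
    FT f p - FT h p = FT (fun x => f x - h x) p := by
  have key : ∀ f : ℝ → ℝ, Integrable f →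
      Integrable (fun x : ℝ => (f x : ℂ) * Complex.exp (-(Complex.I * p * x))) := by
    intro f hf
    apply Integrable.mul_bdd (c := 1) hf.ofReal
    · exact (by fun_prop : Continuous fun x : ℝ =>
        Complex.exp (-(Complex.I * p * x))).aestronglyMeasurable
    · filter_upwards with x
      rw [Complex.norm_exp]
      simp
  unfold FT
  rw [← mul_sub, ← integral_sub (key f hf) (key h hh)]
  congr 2
  ext x
  push_cast
  ring

lemma cs_lint (T : ℝ) (φ : ℝ → ENNReal) (hφ : Measurable φ) :
    (∫⁻ s in Set.Ioc 0 T, φ s) ^ 2 ≤ ENNReal.ofReal T * ∫⁻ s in Set.Ioc 0 T, φ s ^ 2 := by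
  have h := ENNReal.lintegral_mul_le_Lp_mul_Lq (volume.restrict (Set.Ioc 0 T))
    Real.HolderConjugate.two_two (f := fun _ => 1) (g := φ) aemeasurable_const hφ.aemeasurable
  have h2 := pow_le_pow_left' h 2
  rw [mul_pow, ← ENNReal.rpow_natCast _ 2, ← ENNReal.rpow_natCast _ 2, ← ENNReal.rpow_natCast _ 2,
    ← ENNReal.rpow_mul, ← ENNReal.rpow_mul] at h2
  norm_num at h2
  exact h2

lemma alg_bound (a b p c A B g : ℝ) (ha : 0 ≤ a) (hc : 0 ≤ c) (hA : c ≤ A) (hB : p ^ 4 * c ≤ B)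
    (hg0 : 0 ≤ g) (hg : g ^ 2 = A ^ 2 + B ^ 2) (lam : ℝ) (hl0 : 0 ≤ lam)
    (hl : lam ≤ p ^ 4 + |b| * |p| + a) :
    (1 + p ^ 8 + 2 * lam ^ 2) * c ^ 2 ≤ g ^ 2 * (1 + 2 * (a + |b| + 1) ^ 2) := by
  have hp4 : 0 ≤ p ^ 4 := by positivity
  have hpc : 0 ≤ p ^ 4 * c := by positivity
  have h1 : c ^ 2 ≤ A ^ 2 := by gcongr
  have h2 : (p ^ 4 * c) ^ 2 ≤ B ^ 2 := by gcongr
  have h3 : c ≤ g := by nlinarith [sq_nonneg B]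
  have h4 : p ^ 4 * c ≤ g := by
    apply le_of_sq_le_sq _ hg0
    nlinarith [sq_nonneg A]
  have h5 : |p| * c ≤ g := by
    rcases le_total |p| 1 with h | h
    · nlinarith
    · have : |p| ≤ p ^ 4 := by
        rw [← Even.pow_abs (by decide : Even 4) p]
        exact le_self_pow₀ h (by norm_num)
      nlinarith
  have h6 : lam * c ≤ g * (a + |b| + 1) := by
    calc lam * c ≤ (p ^ 4 + |b| * |p| + a) * c := by gcongr
      _ = p ^ 4 * c + |b| * (|p| * c) + a * c := by ring
      _ ≤ g + |b| * g + a * g := by gcongr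
      _ = _ := by ring
  have h7 : (lam * c) ^ 2 ≤ (g * (a + |b| + 1)) ^ 2 := by gcongr
  nlinarith

lemma W_bound (a b T t p : ℝ) (ha : 0 ≤ a) (ht : t ∈ Set.Ioc 0 T)
    (γ c : ℂ) (h : ℝ → ℂ) (hh : Measurable h) :
    ‖∫ s in (0:ℝ)..t,
      Complex.exp (((t - s : ℝ) : ℂ) * (-(p : ℂ) ^ 4 + Complex.I * b * p + a)) * γ * c * h s‖ₑ ^ 2
      ≤ ENNReal.ofReal (Real.exp (2 * a * T) * T * ‖γ * c‖ ^ 2) *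
        ∫⁻ s in Set.Ioc 0 T, ‖h s‖ₑ ^ 2 := by
  obtain ⟨ht0, htT⟩ := ht
  have hT : 0 ≤ T := ht0.le.trans htT
  have h1 : ‖∫ s in (0:ℝ)..t,
      Complex.exp (((t - s : ℝ) : ℂ) * (-(p : ℂ) ^ 4 + Complex.I * b * p + a)) * γ * c * h s‖ₑ
      ≤ ENNReal.ofReal (Real.exp (a * T) * ‖γ * c‖) * ∫⁻ s in Set.Ioc 0 T, ‖h s‖ₑ := by
    rw [intervalIntegral.integral_of_le ht0.le]
    refine (enorm_integral_le_lintegral_enorm _).trans ?_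
    rw [← lintegral_const_mul' _ _ ENNReal.ofReal_ne_top]
    refine le_trans ?_ (lintegral_mono_set (Set.Ioc_subset_Ioc_right htT))
    refine setLIntegral_mono' measurableSet_Ioc ?_
    rintro s ⟨hs0, hst⟩
    rw [enorm_mul, mul_assoc _ γ c, enorm_mul]
    gcongr
    rw [← ofReal_norm, ← ofReal_norm, ← ENNReal.ofReal_mul (norm_nonneg _)]
    apply ENNReal.ofReal_le_ofReal
    gcongr
    rw [Complex.norm_exp]
    apply Real.exp_le_exp.2
    rw [Complex.re_ofReal_mul]
    have e : (-(p : ℂ) ^ 4 + Complex.I * b * p + a).re = -p ^ 4 + a := by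
      rw [← Complex.ofReal_pow]
      simp only [Complex.add_re, Complex.neg_re, Complex.ofReal_re, Complex.mul_re, Complex.I_re,
        Complex.I_im, Complex.ofReal_im, Complex.mul_im]
      ring
    rw [e]
    have hp4 : 0 ≤ p ^ 4 := by positivity
    nlinarith [mul_nonneg (sub_nonneg.2 hst) hp4, mul_nonneg ha (by linarith : 0 ≤ T - (t - s))]
  refine (pow_le_pow_left' h1 2).trans ?_
  rw [mul_pow]
  refine (mul_le_mul_right (cs_lint T _ hh.enorm) _).trans ?_
  rw [← mul_assoc, ← ENNReal.ofReal_pow (by positivity), ← ENNReal.ofReal_mul (by positivity)]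
  apply le_of_eq
  congr 2
  rw [show 2 * a * T = a * T + a * T by ring, Real.exp_add]
  ring

lemma lam_bound (a b p : ℝ) (ha : 0 ≤ a) :
    ‖-(p : ℂ) ^ 4 + Complex.I * b * p + a‖ ≤ p ^ 4 + |b| * |p| + a := by
  refine (norm_add₃_le).trans ?_
  simp [Even.pow_abs (by decide : Even 4), abs_of_nonneg ha]

lemma D_bound (x y : ℂ) : ‖x + y‖ ^ 2 ≤ 2 * ‖x‖ ^ 2 + 2 * ‖y‖ ^ 2 := by
  have := norm_add_le x y
  have h2 : ‖x + y‖ ^ 2 ≤ (‖x‖ + ‖y‖) ^ 2 := by gcongr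
  nlinarith [sq_nonneg (‖x‖ - ‖y‖)]

lemma ofReal_integral_le {α : Type*} [MeasurableSpace α] (μ : Measure α) (f : α → ℝ)
    (hf : ∀ x, 0 ≤ f x) : ENNReal.ofReal (∫ x, f x ∂μ) ≤ ∫⁻ x, ENNReal.ofReal (f x) ∂μ := by
  have := enorm_integral_le_lintegral_enorm (μ := μ) f
  have h0 : 0 ≤ ∫ x, f x ∂μ := integral_nonneg hf
  simp only [← ofReal_norm, Real.norm_eq_abs, abs_of_nonneg (hf _), abs_of_nonneg h0] at this
  exact this

lemma V_bound (T : ℝ) (hT : 0 < T) (v₁ v₂ : ℝ → ℝ → ℝ)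
    (hv₁meas : Measurable (Function.uncurry v₁))
    (hv₂meas : Measurable (Function.uncurry v₂))
    (hv₁2 : ∀ᵐ t ∂(volume.restrict (Set.Icc (0:ℝ) T)),
      Integrable (fun x => (v₁ x t) ^ 2))
    (hv₂2 : ∀ᵐ t ∂(volume.restrict (Set.Icc (0:ℝ) T)),
      Integrable (fun x => (v₂ x t) ^ 2))
    (hv₁L2 : (∫⁻ t in Set.Icc (0:ℝ) T,
      ENNReal.ofReal (∫ x : ℝ, (v₁ x t) ^ 2)) < ⊤)
    (hv₂L2 : (∫⁻ t in Set.Icc (0:ℝ) T,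
      ENNReal.ofReal (∫ x : ℝ, (v₂ x t) ^ 2)) < ⊤) :
    ∫⁻ t in Set.Ioc 0 T, ∫⁻ x, ENNReal.ofReal ((v₁ x t - v₂ x t) ^ 2)
      = ENNReal.ofReal (∫ t in (0:ℝ)..T, ∫ x : ℝ, (v₁ x t - v₂ x t) ^ 2) := by
  have hsub : Set.Ioc (0:ℝ) T ⊆ Set.Icc 0 T := Set.Ioc_subset_Icc_self
  replace hv₁2 := ae_restrict_of_ae_restrict_of_subset hsub hv₁2
  replace hv₂2 := ae_restrict_of_ae_restrict_of_subset hsub hv₂2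
  replace hv₁L2 := (lintegral_mono_set hsub).trans_lt hv₁L2
  replace hv₂L2 := (lintegral_mono_set hsub).trans_lt hv₂L2
  have hms : ∀ v : ℝ → ℝ → ℝ, Measurable (Function.uncurry v) → ∀ t, Measurable (fun x => v x t) :=
    fun v hv t => hv.comp (measurable_id.prodMk measurable_const)
  have hpt : ∀ x t, (v₁ x t - v₂ x t) ^ 2 ≤ 2 * v₁ x t ^ 2 + 2 * v₂ x t ^ 2 := by
    intro x t; nlinarith [sq_nonneg (v₁ x t + v₂ x t)]
  have hint : ∀ᵐ t ∂(volume.restrict (Set.Ioc (0:ℝ) T)),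
      Integrable (fun x => (v₁ x t - v₂ x t) ^ 2) := by
    filter_upwards [hv₁2, hv₂2] with t h1 h2
    refine ((h1.const_mul 2).add (h2.const_mul 2)).mono'
      (((hms _ hv₁meas t).sub (hms _ hv₂meas t)).pow_const 2).aestronglyMeasurable ?_
    filter_upwards with x
    rw [Real.norm_of_nonneg (sq_nonneg _)]
    exact hpt x t
  have hJm : StronglyMeasurable (fun t => ∫ x : ℝ, (v₁ x t - v₂ x t) ^ 2) := by
    apply StronglyMeasurable.integral_prod_right'
      (f := fun y : ℝ × ℝ => (v₁ y.2 y.1 - v₂ y.2 y.1) ^ 2)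
    exact (((hv₁meas.comp measurable_swap).sub (hv₂meas.comp measurable_swap)).pow_const
      2).stronglyMeasurable
  have h1 : ∫⁻ t in Set.Ioc 0 T, ∫⁻ x, ENNReal.ofReal ((v₁ x t - v₂ x t) ^ 2)
      = ∫⁻ t in Set.Ioc 0 T, ENNReal.ofReal (∫ x, (v₁ x t - v₂ x t) ^ 2) := by
    apply lintegral_congr_ae
    filter_upwards [hint] with t h
    rw [ofReal_integral_eq_lintegral_ofReal h]
    filter_upwards with x
    exact sq_nonneg _
  have hfin : ∫⁻ t in Set.Ioc 0 T, ENNReal.ofReal (∫ x, (v₁ x t - v₂ x t) ^ 2) < ⊤ := by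
    have : ∫⁻ t in Set.Ioc 0 T, ENNReal.ofReal (∫ x, (v₁ x t - v₂ x t) ^ 2) ≤
        ∫⁻ t in Set.Ioc 0 T, (2 * ENNReal.ofReal (∫ x, (v₁ x t) ^ 2)
          + 2 * ENNReal.ofReal (∫ x, (v₂ x t) ^ 2)) := by
      apply lintegral_mono_ae
      filter_upwards [hv₁2, hv₂2, hint] with t h1 h2 h3
      rw [show (2 : ENNReal) = ENNReal.ofReal 2 by simp, ← ENNReal.ofReal_mul (by norm_num),
        ← ENNReal.ofReal_mul (by norm_num),
        ← ENNReal.ofReal_add (mul_nonneg (by norm_num) (integral_nonneg fun _ => sq_nonneg _))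
          (mul_nonneg (by norm_num) (integral_nonneg fun _ => sq_nonneg _))]
      apply ENNReal.ofReal_le_ofReal
      rw [← integral_const_mul, ← integral_const_mul,
        ← integral_add (h1.const_mul 2) (h2.const_mul 2)]
      exact integral_mono h3 ((h1.const_mul 2).add (h2.const_mul 2)) (fun x => hpt x t)
    refine this.trans_lt ?_
    have hm1 : Measurable (fun t => 2 * ENNReal.ofReal (∫ x, (v₁ x t) ^ 2)) := by
      apply Measurable.const_mul
      apply ENNReal.measurable_ofReal.comp
      apply StronglyMeasurable.measurable
      apply StronglyMeasurable.integral_prod_right' (f := fun y : ℝ × ℝ => (v₁ y.2 y.1) ^ 2)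
      exact ((hv₁meas.comp measurable_swap).pow_const 2).stronglyMeasurable
    rw [lintegral_add_left hm1, lintegral_const_mul' _ _ (by simp),
      lintegral_const_mul' _ _ (by simp)]
    exact ENNReal.add_lt_top.2 ⟨ENNReal.mul_lt_top (by simp) hv₁L2,
      ENNReal.mul_lt_top (by simp) hv₂L2⟩
  have hJ : Integrable (fun t => ∫ x : ℝ, (v₁ x t - v₂ x t) ^ 2)
      (volume.restrict (Set.Ioc (0:ℝ) T)) := by
    refine ⟨hJm.aestronglyMeasurable, ?_⟩
    rw [hasFiniteIntegral_iff_ofReal]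
    · exact hfin
    · filter_upwards with t
      exact integral_nonneg fun _ => sq_nonneg _
  rw [h1, intervalIntegral.integral_of_le hT.le, ofReal_integral_eq_lintegral_ofReal hJ]
  filter_upwards with t
  exact integral_nonneg fun _ => sq_nonneg _


set_option maxHeartbeats 1000000 in
theorem stmt15 (a b T l : ℝ) (ha : 0 ≤ a) (hT : 0 < T) (hl : 0 < l)
    (G : ℝ → ℝ) (hGsmooth : ContDiff ℝ 4 G)
    (hGint : ∀ n : ℕ, n ≤ 4 → Integrable (iteratedDeriv n G))
    (hGdecay : ∀ n : ℕ, n ≤ 3 →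
      Filter.Tendsto (iteratedDeriv n G) (Filter.cocompact ℝ) (nhds 0))
    (g : ℝ)
    (hg : g = Real.sqrt ((∫ x : ℝ, |G x|) ^ 2 + (∫ x : ℝ, |iteratedDeriv 4 G x|) ^ 2))
    (F : ℝ → ℝ → ℝ) (hFmeas : Measurable (Function.uncurry F))
    (hlip : ∀ u₁ u₂ x : ℝ, |F u₁ x - F u₂ x| ≤ l * |u₁ - u₂|)
    (v₁ v₂ : ℝ → ℝ → ℝ)
    (hv₁meas : Measurable (Function.uncurry v₁))
    (hv₂meas : Measurable (Function.uncurry v₂))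
    (hv₁2 : ∀ᵐ t ∂(volume.restrict (Set.Icc (0:ℝ) T)),
      Integrable (fun x => (v₁ x t) ^ 2))
    (hv₂2 : ∀ᵐ t ∂(volume.restrict (Set.Icc (0:ℝ) T)),
      Integrable (fun x => (v₂ x t) ^ 2))
    (hv₁L2 : (∫⁻ t in Set.Icc (0:ℝ) T,
      ENNReal.ofReal (∫ x : ℝ, (v₁ x t) ^ 2)) < ⊤)
    (hv₂L2 : (∫⁻ t in Set.Icc (0:ℝ) T,
      ENNReal.ofReal (∫ x : ℝ, (v₂ x t) ^ 2)) < ⊤)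
    (hFv₁ : ∀ᵐ s ∂(volume.restrict (Set.Icc (0:ℝ) T)),
      Integrable (fun x => F (v₁ x s) x) ∧ Integrable (fun x => (F (v₁ x s) x) ^ 2))
    (hFv₂ : ∀ᵐ s ∂(volume.restrict (Set.Icc (0:ℝ) T)),
      Integrable (fun x => F (v₂ x s) x) ∧ Integrable (fun x => (F (v₂ x s) x) ^ 2))
    (W : ℝ → ℝ → ℂ)
    (hW : ∀ p t : ℝ, W p t = ∫ s in (0:ℝ)..t,
      Complex.exp (((t - s : ℝ) : ℂ) * (-(p : ℂ) ^ 4 + Complex.I * b * p + a)) *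
        (Real.sqrt (2 * Real.pi) : ℂ) *
        FT G p * (FT (fun x => F (v₁ x s) x) p - FT (fun x => F (v₂ x s) x) p))
    (D : ℝ → ℝ → ℂ)
    (hD : ∀ p t : ℝ, D p t =
      (-(p : ℂ) ^ 4 + Complex.I * b * p + a) * W p t +
        (Real.sqrt (2 * Real.pi) : ℂ) * FT G p *
          (FT (fun x => F (v₁ x t) x) p - FT (fun x => F (v₂ x t) x) p)) :
    ∫ t in (0:ℝ)..T, ∫ p : ℝ,
        (‖W p t‖ ^ 2 + p ^ 8 * ‖W p t‖ ^ 2 + ‖D p t‖ ^ 2) ≤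
      g ^ 2 * l ^ 2 * (T ^ 2 * Real.exp (2 * a * T) * (1 + 2 * (a + |b| + 1) ^ 2) + 2) *
        ∫ t in (0:ℝ)..T, ∫ x : ℝ, (v₁ x t - v₂ x t) ^ 2 := by
  have hsub : Set.Ioc (0:ℝ) T ⊆ Set.Icc 0 T := Set.Ioc_subset_Icc_self
  have hV := V_bound T hT v₁ v₂ hv₁meas hv₂meas hv₁2 hv₂2 hv₁L2 hv₂L2
  have hg0 : 0 ≤ g := by rw [hg]; positivity
  have hg2 : g ^ 2 = (∫ x : ℝ, |G x|) ^ 2 + (∫ x : ℝ, |iteratedDeriv 4 G x|) ^ 2 := by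
    rw [hg, Real.sq_sqrt (by positivity)]
  set V := ∫ t in (0:ℝ)..T, ∫ x : ℝ, (v₁ x t - v₂ x t) ^ 2 with hVdef
  have hV0 : 0 ≤ V := by
    rw [hVdef, intervalIntegral.integral_of_le hT.le]
    exact integral_nonneg fun t => integral_nonneg fun x => sq_nonneg _
  set h : ℝ → ℝ → ℂ := fun p s => FT (fun x => F (v₁ x s) x) p - FT (fun x => F (v₂ x s) x) p
    with hh
  have hFm : ∀ v : ℝ → ℝ → ℝ, Measurable (Function.uncurry v) →
      Measurable (Function.uncurry fun x s => F (v x s) x) := fun v hv =>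
    hFmeas.comp (hv.prodMk measurable_fst)
  have hhm : Measurable (fun z : ℝ × ℝ => h z.1 z.2) :=
    (FT_meas _ (hFm v₁ hv₁meas)).sub (FT_meas _ (hFm v₂ hv₂meas))
  have hhe : Measurable (fun z : ℝ × ℝ => ‖h z.1 z.2‖ₑ ^ 2) := hhm.enorm.pow_const 2
  -- Plancherel and Lipschitz bound
  have hS : ∫⁻ s in Set.Ioc 0 T, ∫⁻ p, ‖h p s‖ₑ ^ 2 ≤ ENNReal.ofReal (l ^ 2 * V) := by
    rw [ENNReal.ofReal_mul (by positivity), ← hV, ← lintegral_const_mul' _ _ ENNReal.ofReal_ne_top]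
    apply lintegral_mono_ae
    filter_upwards [ae_restrict_of_ae_restrict_of_subset hsub hFv₁,
      ae_restrict_of_ae_restrict_of_subset hsub hFv₂] with s h1 h2
    have e : ∀ p, h p s = FT (fun x => F (v₁ x s) x - F (v₂ x s) x) p :=
      fun p => FT_sub _ _ h1.1 h2.1 p
    simp_rw [e]
    have m1 := (memLp_two_iff_integrable_sq h1.1.aestronglyMeasurable).2 h1.2
    have m2 := (memLp_two_iff_integrable_sq h2.1.aestronglyMeasurable).2 h2.2
    rw [FT_sq (fun x => F (v₁ x s) x - F (v₂ x s) x) (h1.1.sub h2.1) (m1.sub m2).integrable_sq,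
      ← lintegral_const_mul' _ _ ENNReal.ofReal_ne_top]
    apply lintegral_mono
    intro x
    beta_reduce
    rw [← ENNReal.ofReal_mul (by positivity)]
    apply ENNReal.ofReal_le_ofReal
    rw [← mul_pow]
    apply sq_le_sq.2
    rw [abs_mul, abs_of_pos hl]
    exact hlip _ _ _
  set I : ℝ → ENNReal := fun p => ∫⁻ s in Set.Ioc 0 T, ‖h p s‖ₑ ^ 2 with hI
  set M := 1 + 2 * (a + |b| + 1) ^ 2 with hM
  have hM0 : 0 ≤ M := by positivity
  set K := Real.exp (2 * a * T) * T * (g ^ 2 * M) with hK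
  have hK0 : 0 ≤ K := by positivity
  have hImeas : Measurable I := hhe.lintegral_prod_right'
  have hIint : ∫⁻ p, I p = ∫⁻ s in Set.Ioc 0 T, ∫⁻ p, ‖h p s‖ₑ ^ 2 :=
    lintegral_lintegral_swap hhe.aemeasurable
  have hpt : ∀ t ∈ Set.Ioc (0:ℝ) T, ∀ p,
      ENNReal.ofReal (‖W p t‖ ^ 2 + p ^ 8 * ‖W p t‖ ^ 2 + ‖D p t‖ ^ 2) ≤
        ENNReal.ofReal K * I p + ENNReal.ofReal (2 * g ^ 2) * ‖h p t‖ₑ ^ 2 := by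
    intro t ht p
    obtain ⟨hA, hB⟩ := FT_G_bounds G hGsmooth hGint p
    have hWb : ‖W p t‖ₑ ^ 2 ≤ ENNReal.ofReal (Real.exp (2 * a * T) * T *
        ‖(Real.sqrt (2 * Real.pi) : ℂ) * FT G p‖ ^ 2) * I p := by
      rw [hW p t]
      exact W_bound a b T t p ha ht (Real.sqrt (2 * Real.pi) : ℂ) (FT G p) (h p)
        (hhm.comp measurable_prodMk_left)
    set c := (Real.sqrt (2 * Real.pi) : ℂ) * FT G p with hc
    set lam := -(p : ℂ) ^ 4 + Complex.I * b * p + a with hlam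
    have hal := alg_bound a b p ‖c‖ _ _ g ha (norm_nonneg _) hA hB hg0 hg2 ‖lam‖ (norm_nonneg _)
      (lam_bound a b p ha)
    have hcg : ‖c‖ ^ 2 ≤ g ^ 2 := by
      have : ‖c‖ ^ 2 ≤ (∫ x : ℝ, |G x|) ^ 2 := by gcongr
      rw [hg2]; nlinarith [sq_nonneg (∫ x : ℝ, |iteratedDeriv 4 G x|)]
    have hDb : ‖D p t‖ ^ 2 ≤ 2 * (‖lam‖ ^ 2 * ‖W p t‖ ^ 2) + 2 * (‖c‖ ^ 2 * ‖h p t‖ ^ 2) := by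
      rw [hD p t]
      refine (D_bound _ _).trans (le_of_eq ?_)
      rw [norm_mul, norm_mul, mul_pow, mul_pow]
    have hq : ‖W p t‖ ^ 2 + p ^ 8 * ‖W p t‖ ^ 2 + ‖D p t‖ ^ 2 ≤
        (1 + p ^ 8 + 2 * ‖lam‖ ^ 2) * ‖W p t‖ ^ 2 + 2 * g ^ 2 * ‖h p t‖ ^ 2 := by
      have : ‖c‖ ^ 2 * ‖h p t‖ ^ 2 ≤ g ^ 2 * ‖h p t‖ ^ 2 := by gcongr
      linarith
    have hp8 : 0 ≤ p ^ 8 := by positivity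
    have e1 : ∀ z : ℂ, ENNReal.ofReal (‖z‖ ^ 2) = ‖z‖ₑ ^ 2 := fun z => by
      rw [ENNReal.ofReal_pow (norm_nonneg _), ofReal_norm]
    refine (ENNReal.ofReal_le_ofReal hq).trans ?_
    rw [ENNReal.ofReal_add (by positivity) (by positivity), ENNReal.ofReal_mul (by positivity),
      ENNReal.ofReal_mul (p := 2 * g ^ 2) (by positivity), e1, e1]
    refine add_le_add ?_ le_rfl
    refine (mul_le_mul_right hWb _).trans ?_
    rw [← mul_assoc, ← ENNReal.ofReal_mul (by positivity)]
    gcongr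
    rw [hK]
    calc _ = Real.exp (2 * a * T) * T * ((1 + p ^ 8 + 2 * ‖lam‖ ^ 2) * ‖c‖ ^ 2) := by ring
      _ ≤ _ := by gcongr
  have hq0 : ∀ t p, 0 ≤ ‖W p t‖ ^ 2 + p ^ 8 * ‖W p t‖ ^ 2 + ‖D p t‖ ^ 2 := by
    intro t p
    have hp8 : 0 ≤ p ^ 8 := by positivity
    positivity
  have hR0 : 0 ≤ g ^ 2 * l ^ 2 * (T ^ 2 * Real.exp (2 * a * T) * M + 2) * V := by positivity
  refine (ENNReal.ofReal_le_ofReal_iff hR0).1 ?_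
  rw [intervalIntegral.integral_of_le hT.le]
  set S := ∫⁻ s in Set.Ioc 0 T, ∫⁻ p, ‖h p s‖ₑ ^ 2 with hSdef
  calc _ ≤ ∫⁻ t in Set.Ioc 0 T, ENNReal.ofReal (∫ p : ℝ,
        (‖W p t‖ ^ 2 + p ^ 8 * ‖W p t‖ ^ 2 + ‖D p t‖ ^ 2)) :=
        ofReal_integral_le _ _ fun t => integral_nonneg (hq0 t)
    _ ≤ ∫⁻ t in Set.Ioc 0 T, (ENNReal.ofReal K * S +
          ENNReal.ofReal (2 * g ^ 2) * ∫⁻ p, ‖h p t‖ₑ ^ 2) := by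
        refine setLIntegral_mono' measurableSet_Ioc fun t ht => ?_
        refine (ofReal_integral_le _ _ (hq0 t)).trans ?_
        refine (lintegral_mono (hpt t ht)).trans (le_of_eq ?_)
        rw [lintegral_add_left (hImeas.const_mul _), lintegral_const_mul' _ _ ENNReal.ofReal_ne_top,
          lintegral_const_mul' _ _ ENNReal.ofReal_ne_top, hIint]
    _ = ENNReal.ofReal (K * T + 2 * g ^ 2) * S := by
        rw [lintegral_add_left measurable_const, lintegral_const,
          lintegral_const_mul' _ _ ENNReal.ofReal_ne_top, Measure.restrict_apply MeasurableSet.univ, Set.univ_inter,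
          Real.volume_Ioc, sub_zero, ENNReal.ofReal_add (by positivity) (by positivity),
          ENNReal.ofReal_mul hK0, add_mul, ← hSdef]
        ring
    _ ≤ ENNReal.ofReal (K * T + 2 * g ^ 2) * ENNReal.ofReal (l ^ 2 * V) := by gcongr
    _ = _ := by
        rw [← ENNReal.ofReal_mul (by positivity), hK]
        congr 1
        ring
end
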